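/- If the fundamental tensor F satisfies the defining condition of class F₂, then the torsion tensor T¹ of the first natural connection satisfies T¹(ξ,y,z) = 0, T¹(x,y,ξ) = 0, T¹(x,y,z) = −T¹(φx,φy,z) for all x, y, z ∈ V, and the torsion form ṫ vanishes identically. -/

import Mathlib

open scoped RealInnerProductSpace

noncomputable section

variable {V : Type*} [NormedAddCommGroup V] [InnerProductSpace ℝ V]

/-- A Riemannian Π-structure on a real inner product space `V`:
a linear map `phi`, a vector `xi` (with dual form `η x = ⟪x, xi⟫`) satisfying
the defining algebraic identities. -/
structure PiStruct (V : Type*) [NormedAddCommGroup V] [InnerProductSpace ℝ V] where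
  phi : V →ₗ[ℝ] V
  xi : V
  phi_xi : phi xi = 0
  phi_phi : ∀ x : V, phi (phi x) = x - (⟪x, xi⟫ : ℝ) • xi
  eta_phi : ∀ x : V, ⟪phi x, xi⟫ = 0
  eta_xi : ⟪xi, xi⟫ = (1 : ℝ)
  g_phi_phi : ∀ x y : V, ⟪phi x, phi y⟫ = ⟪x, y⟫ - ⟪x, xi⟫ * ⟪y, xi⟫
  g_phi_symm : ∀ x y : V, ⟪phi x, y⟫ = ⟪x, phi y⟫

/-- Trilinear real-valued maps on `V`. -/
abbrev Tri (V : Type*) [NormedAddCommGroup V] [InnerProductSpace ℝ V] :=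
  V →ₗ[ℝ] V →ₗ[ℝ] V →ₗ[ℝ] ℝ

/-- The 1-form `η(x) = g(x, ξ)`. -/
def PiStruct.eta (P : PiStruct V) (x : V) : ℝ := ⟪x, P.xi⟫

/-- `F` is a fundamental tensor for the Π-structure `P`. -/
def IsFund (P : PiStruct V) (F : Tri V) : Prop :=
  (∀ x y z : V, F x y z = F x z y) ∧
  (∀ x y z : V, F x y z =
    -F x (P.phi y) (P.phi z) + P.eta y * F x P.xi z + P.eta z * F x y P.xi)

/-- The Nijenhuis tensor of `F`. -/
def Nij (P : PiStruct V) (F : Tri V) (x y z : V) : ℝ :=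
  F (P.phi x) y z - F (P.phi y) x z - F x y (P.phi z) + F y x (P.phi z)
    + P.eta z * (F x (P.phi y) P.xi - F y (P.phi x) P.xi)

/-- The potential of the first natural connection. -/
def Q1 (P : PiStruct V) (F : Tri V) (x y z : V) : ℝ :=
  -(1/2) * F x (P.phi y) z - (1/2) * P.eta z * F x (P.phi y) P.xi
    + P.eta y * F x (P.phi z) P.xi

/-- The potential of the second natural connection. -/
def Q2 (P : PiStruct V) (F : Tri V) (x y z : V) : ℝ :=
  Q1 P F x y z - (1/8) * (Nij P F (P.phi (P.phi z)) (P.phi (P.phi y)) (P.phi (P.phi x))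
    + 2 * P.eta x * Nij P F (P.phi z) (P.phi y) P.xi)

/-- The torsion tensor of the first natural connection. -/
def T1 (P : PiStruct V) (F : Tri V) (x y z : V) : ℝ :=
  -(1/2) * (F x (P.phi y) z - F y (P.phi x) z)
    - (1/2) * P.eta z * (F x (P.phi y) P.xi - F y (P.phi x) P.xi)
    + P.eta y * F x (P.phi z) P.xi - P.eta x * F y (P.phi z) P.xi

/-- The torsion tensor of the second natural connection. -/
def T2 (P : PiStruct V) (F : Tri V) (x y z : V) : ℝ :=
  Q2 P F x y z - Q2 P F y x z

/-- Identity (*) for a torsion-like tensor `T`. -/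
def StarId (P : PiStruct V) (T : V → V → V → ℝ) : Prop :=
  ∀ x y z : V,
    T x y z + T y z x + T (P.phi x) y (P.phi z) + T y (P.phi z) (P.phi x)
    - P.eta x * (T P.xi y z + T y z P.xi - P.eta y * T P.xi z P.xi)
    - P.eta y * (T x P.xi z + T P.xi z x + T (P.phi x) P.xi (P.phi z)
        + T P.xi (P.phi z) (P.phi x))
    - P.eta z * (T x y P.xi + T y P.xi x - P.eta y * T x P.xi P.xi) = 0

/-- If `F` vanishes whenever its second argument is `ξ`, then each `F x` is skew with respect
to `φ`. -/
theorem IsFund.apply_phi_left {P : PiStruct V} {F : Tri V} (hF : IsFund P F)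
    (hxi : ∀ x z : V, F x P.xi z = 0) (x y z : V) :
    F x (P.phi y) z = -F x y (P.phi z) := by
  have h := hF.2 x (P.phi y) z
  simpa [P.phi_phi, hxi, hF.1 x _ P.xi] using h

/-- For `F` vanishing whenever its second argument is `ξ`, the torsion reduces to its leading
part. -/
theorem IsFund.T1_eq {P : PiStruct V} {F : Tri V} (hF : IsFund P F)
    (hxi : ∀ x z : V, F x P.xi z = 0) (x y z : V) :
    T1 P F x y z = -(1/2) * (F x (P.phi y) z - F y (P.phi x) z) := by
  simp [T1, hxi, hF.1 _ _ P.xi]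

/-- if `F` is in the class F₂ then the torsion `T¹` of the first natural
connection satisfies `T¹(ξ,y,z) = 0`, `T¹(x,y,ξ) = 0`, `T¹(x,y,z) = −T¹(φx,φy,z)`,
and the torsion form `ṫ` vanishes identically. -/
theorem classF2_T1_properties
    [FiniteDimensional ℝ V] (n : ℕ) (hn : 1 ≤ n)
    (hdim : Module.finrank ℝ V = 2 * n + 1)
    (P : PiStruct V) (F : Tri V) (hF : IsFund P F)
    (e : Fin (2 * n) → V) (he : Orthonormal ℝ e)
    (heker : ∀ i, ⟪e i, P.xi⟫ = (0 : ℝ))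
    (hespan : ∀ x : V, ⟪x, P.xi⟫ = (0 : ℝ) → x ∈ Submodule.span ℝ (Set.range e))
    (hF2a : ∀ y z : V, F P.xi y z = 0)
    (hF2b : ∀ x z : V, F x P.xi z = 0)
    (hF2c : ∀ z : V, (∑ i, F (e i) (e i) z) = 0)
    (hF2d : ∀ x y z : V, F x y (P.phi z) + F y z (P.phi x) + F z x (P.phi y) = 0) :
    (∀ y z : V, T1 P F P.xi y z = 0) ∧
    (∀ x y : V, T1 P F x y P.xi = 0) ∧
    (∀ x y z : V, T1 P F x y z = -T1 P F (P.phi x) (P.phi y) z) ∧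
    (∀ x : V, (∑ i, T1 P F x (e i) (e i)) = 0) := by
  have hT := hF.T1_eq hF2b
  have hskew := hF.apply_phi_left hF2b
  have hphi : ∀ x y z : V, F x y (P.phi (P.phi z)) = F x y z := fun x y z => by
    simp [P.phi_phi, hF.1 x y P.xi, hF2b]
  refine ⟨fun y z => ?_, fun x y => ?_, fun x y z => ?_, fun x => ?_⟩
  · simp [hT, hF2a, P.phi_xi]
  · simp [hT, hF.1 _ _ P.xi, hF2b]
  · have hcyc : ∀ x y z : V, F (P.phi x) y z = F (P.phi z) x y - F y (P.phi z) x := by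
      intro x y z
      linarith [hF2d y (P.phi z) (P.phi x), hphi y (P.phi z) x, hskew (P.phi z) x (P.phi y),
        hphi (P.phi z) x y, hphi (P.phi x) y z]
    rw [hT, hT]
    have hphi' : ∀ x y z : V, F x (P.phi (P.phi y)) z = F x y z := fun x y z => by
      rw [hF.1, hphi, hF.1]
    rw [hphi', hphi']
    linarith [hcyc x y z, hcyc y x z, hF.1 (P.phi z) x y, hskew x z y, hskew y z x,
      hF.1 x z (P.phi y), hF.1 y z (P.phi x)]
  · have hdiag : ∀ i, F x (P.phi (e i)) (e i) = 0 := fun i => by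
      linarith [hskew x (e i) (e i), hF.1 x (P.phi (e i)) (e i)]
    simp only [hT, hdiag, hF.1 _ (P.phi x), zero_sub, ← Finset.mul_sum, Finset.sum_neg_distrib,
      hF2c, neg_zero, mul_zero]
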